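/- Define F(p,z|τ) := θ(p+z|τ)/(θ(p|τ)·θ(z|τ)). For every τ in the upper half-plane, all t, t′ ∈ ℂ, and all complex numbers p, p′, z, z′ such that θ(p|τ), θ(p′|τ), θ(z|τ), θ(z′|τ), θ(p+p′|τ) and θ(z+z′|τ) are all nonzero, one has F(p,z|τ)·e^{−tz}·F(p+p′,z′|τ)·e^{−(t+t′)z′} − F(p′,z′|τ)·e^{−t′z′}·F(p,z+z′|τ)·e^{−t(z+z′)} + F(p+p′,z+z′|τ)·e^{−(t+t′)(z+z′)}·F(p′,−z|τ)·e^{t′z} = 0. -/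

import Mathlib

noncomputable section

open Complex

/-- `e(w) := exp(2πi·w)`. -/
def ce (w : ℂ) : ℂ := Complex.exp (2 * Real.pi * Complex.I * w)

/-- The theta function
`θ(z|τ) := (1/(2πi))·(e(z/2) − e(−z/2))·∏_{j≥1}(1 − e(z+jτ))·∏_{j≥1}(1 − e(−z+jτ))`. -/
def theta (z τ : ℂ) : ℂ :=
  (1 / (2 * Real.pi * Complex.I)) * (ce (z / 2) - ce (-z / 2)) *
    ((∏' j : ℕ, (1 - ce (z + ((j : ℂ) + 1) * τ))) *
      ∏' j : ℕ, (1 - ce (-z + ((j : ℂ) + 1) * τ)))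

/-- `F(p,z|τ) := θ(p+z|τ)/(θ(p|τ)·θ(z|τ))`. -/
def Ftheta (p z τ : ℂ) : ℂ := theta (p + z) τ / (theta p τ * theta z τ)

open Filter Topology

/-- finite q-Pochhammer product. -/
def qphi (q : ℂ) (n : ℕ) : ℂ := ∏ j ∈ Finset.range n, (1 - q ^ (j + 1))

/-- reciprocal of `qphi`, extended by zero to negative integers. -/
def qrec (q : ℂ) (m : ℤ) : ℂ := if m < 0 then 0 else (qphi q m.toNat)⁻¹

lemma one_sub_pow_ne {q : ℂ} (hq : ‖q‖ < 1) (j : ℕ) : 1 - q ^ (j + 1) ≠ 0 := by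
  intro h
  have h1 : q ^ (j + 1) = 1 := (sub_eq_zero.mp h).symm
  have h2 : ‖q‖ ^ (j + 1) = 1 := by rw [← norm_pow, h1, norm_one]
  have h3 : ‖q‖ ^ (j + 1) < 1 := pow_lt_one₀ (norm_nonneg _) hq (Nat.succ_ne_zero j)
  linarith

lemma qphi_ne {q : ℂ} (hq : ‖q‖ < 1) (n : ℕ) : qphi q n ≠ 0 :=
  Finset.prod_ne_zero_iff.mpr fun j _ => one_sub_pow_ne hq j

lemma qrec_pred {q : ℂ} (hq : ‖q‖ < 1) (m : ℤ) : qrec q (m - 1) = (1 - q ^ m) * qrec q m := by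
  unfold qrec
  rcases lt_trichotomy m 0 with h | h | h
  · rw [if_pos h, if_pos (by omega), mul_zero]
  · subst h; simp
  · rw [if_neg (by omega), if_neg (by omega)]
    obtain ⟨n, rfl⟩ : ∃ n : ℕ, m = n + 1 := ⟨(m - 1).toNat, by omega⟩
    have e1 : ((n : ℤ) + 1 - 1).toNat = n := by omega
    have e2 : ((n : ℤ) + 1).toNat = n + 1 := by omega
    rw [e1, e2]
    have e3 : q ^ ((n : ℤ) + 1) = q ^ (n + 1) := by exact_mod_cast zpow_natCast q (n + 1)
    rw [e3]
    have := one_sub_pow_ne hq n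
    have h2 := qphi_ne hq n
    have h3 : qphi q (n + 1) = qphi q n * (1 - q ^ (n + 1)) := by
      unfold qphi; rw [Finset.prod_range_succ]
    rw [h3]; field_simp

lemma summable_geo {q : ℂ} (hq : ‖q‖ < 1) (a : ℂ) : Summable fun j : ℕ => ‖-(a * q ^ j)‖ := by
  have := (summable_geometric_of_lt_one (norm_nonneg q) hq).mul_left ‖a‖
  refine this.congr fun j => ?_
  rw [norm_neg, norm_mul, norm_pow]

lemma mult_geo {q : ℂ} (hq : ‖q‖ < 1) (a : ℂ) : Multipliable fun j : ℕ => (1 - a * q ^ j) := by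
  have := multipliable_one_add_of_summable (summable_geo hq a)
  simpa [sub_eq_add_neg] using this

lemma qphi_tendsto {q : ℂ} (hq : ‖q‖ < 1) :
    ∃ L : ℂ, L ≠ 0 ∧ Tendsto (qphi q) atTop (𝓝 L) := by
  refine ⟨∏' j : ℕ, (1 - q * q ^ j), ?_, ?_⟩
  · have := tprod_one_add_ne_zero_of_summable (f := fun j : ℕ => -(q * q ^ j)) (fun j => ?_)
      (summable_geo hq q)
    · simpa [sub_eq_add_neg] using this
    · have := one_sub_pow_ne hq j
      rwa [pow_succ', sub_eq_add_neg] at this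
  · have := (mult_geo hq q).tendsto_prod_tprod_nat
    refine this.congr fun n => ?_
    unfold qphi
    exact Finset.prod_congr rfl fun j _ => by rw [pow_succ']

lemma bdd_of_tendsto {f : ℕ → ℂ} {L : ℂ} (h : Tendsto f atTop (𝓝 L)) :
    ∃ C : ℝ, 0 ≤ C ∧ ∀ n, ‖f n‖ ≤ C := by
  obtain ⟨C, hC⟩ := (Metric.isBounded_range_of_tendsto f h).exists_norm_le
  exact ⟨C, (norm_nonneg _).trans (hC (f 0) ⟨0, rfl⟩), fun n => hC _ ⟨n, rfl⟩⟩

/-- the common theta shift -/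
def tsh (z τ : ℂ) : ℂ := z + 1 / 2 + τ / 2

lemma term_succ (k : ℤ) (z τ : ℂ) :
    jacobiTheta₂_term (k + 1) (tsh z τ) τ
      = -(ce z * ce τ ^ (k + 1)) * jacobiTheta₂_term k (tsh z τ) τ := by
  have h : (-1 : ℂ) = Complex.exp (Real.pi * I) := Complex.exp_pi_mul_I.symm
  rw [neg_eq_neg_one_mul, h]
  unfold jacobiTheta₂_term tsh ce
  rw [← Complex.exp_int_mul, ← Complex.exp_add, ← Complex.exp_add, ← Complex.exp_add]
  congr 1
  push_cast
  ring

/-- coefficients of the finite triple product -/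
def bco (z τ : ℂ) (n : ℕ) (k : ℤ) : ℂ :=
  jacobiTheta₂_term k (tsh z τ) τ * (qphi (ce τ) (2 * n) * qrec (ce τ) (n - k) * qrec (ce τ) (n + k))

lemma ce_ne (z : ℂ) : ce z ≠ 0 := Complex.exp_ne_zero _

lemma norm_ce {τ : ℂ} (hτ : 0 < τ.im) : ‖ce τ‖ < 1 := by
  unfold ce
  rw [Complex.norm_exp, Real.exp_lt_one_iff]
  simp
  positivity

lemma bco_succ {τ : ℂ} (hτ : 0 < τ.im) (z : ℂ) (n : ℕ) (k : ℤ) :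
    bco z τ (n + 1) k = (1 + ce τ ^ (2 * n + 1)) * bco z τ n k
      - ce z * ce τ ^ (n + 1) * bco z τ n (k - 1) - (ce z)⁻¹ * ce τ ^ n * bco z τ n (k + 1) := by
  have hq := norm_ce hτ
  have hq0 := ce_ne τ
  have hx := ce_ne z
  have t1 := term_succ k z τ
  have t2 := term_succ (k - 1) z τ
  unfold bco
  rw [t1]
  rw [sub_add_cancel] at t2
  rw [t2]
  set T := jacobiTheta₂_term (k - 1) (tsh z τ) τ
  set q := ce τ with hqd
  set x := ce z
  have p1 : qphi q (2 * (n + 1)) = qphi q (2 * n) * (1 - q ^ (2 * n + 1)) * (1 - q ^ (2 * n + 2)) := by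
    unfold qphi; rw [show 2 * (n + 1) = 2 * n + 1 + 1 by ring, Finset.prod_range_succ, Finset.prod_range_succ]
  have r1 : qrec q (n - k) = (1 - q ^ ((n : ℤ) + 1 - k)) * qrec q ((n : ℤ) + 1 - k) := by
    rw [← qrec_pred hq]; congr 1; ring
  have r2 : qrec q (n + k) = (1 - q ^ ((n : ℤ) + 1 + k)) * qrec q ((n : ℤ) + 1 + k) := by
    rw [← qrec_pred hq]; congr 1; ring
  have r3 : qrec q (n - (k + 1)) = (1 - q ^ ((n : ℤ) - k)) * qrec q ((n : ℤ) - k) := by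
    rw [← qrec_pred hq]; congr 1; ring
  have r4 : qrec q (n + (k - 1)) = (1 - q ^ ((n : ℤ) + k)) * qrec q ((n : ℤ) + k) := by
    rw [← qrec_pred hq]; congr 1; ring
  rw [r3, r4, r1, r2, p1]
  rw [show (n : ℤ) - (k - 1) = n + 1 - k by ring, show (n : ℤ) + (k + 1) = n + 1 + k by ring]
  push_cast
  set R := qrec q ((n : ℤ) + 1 - k)
  set S := qrec q ((n : ℤ) + 1 + k)
  set P := qphi q (2 * n)
  simp only [zpow_sub₀ hq0, zpow_add₀ hq0, zpow_natCast, zpow_one]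
  have hK : q ^ k ≠ 0 := zpow_ne_zero k hq0
  set K := q ^ k
  have e1 : q ^ (2 * n + 1) = q ^ n * q ^ n * q := by ring
  have e2 : q ^ (2 * n + 2) = q ^ n * q ^ n * q * q := by ring
  rw [e1, e2, pow_succ]
  set N := q ^ n
  field_simp
  ring

lemma finite_triple {τ : ℂ} (hτ : 0 < τ.im) (z : ℂ) (n : ℕ) :
    HasSum (bco z τ n)
      (∏ j ∈ Finset.range n, ((1 - ce z * ce τ * ce τ ^ j) * (1 - (ce z)⁻¹ * ce τ ^ j))) := by
  induction n with
  | zero =>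
    have h0 : bco z τ 0 0 = 1 := by simp [bco, qphi, qrec, jacobiTheta₂_term]
    rw [Finset.prod_range_zero, ← h0]
    refine hasSum_single 0 fun k hk => ?_
    unfold bco qrec
    rcases lt_or_gt_of_ne hk with h | h
    · rw [if_pos (show ((0 : ℕ) : ℤ) + k < 0 by simpa using h)]; simp
    · rw [if_pos (show ((0 : ℕ) : ℤ) - k < 0 by simpa using h)]; simp
  | succ n ih =>
    rw [Finset.prod_range_succ]
    set P := ∏ j ∈ Finset.range n, ((1 - ce z * ce τ * ce τ ^ j) * (1 - (ce z)⁻¹ * ce τ ^ j))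
    have i1 : HasSum (fun k => bco z τ n (k - 1)) P := by
      have := ((Equiv.subRight (1 : ℤ)).hasSum_iff (f := bco z τ n) (a := P)).mpr ih
      exact this
    have i2 : HasSum (fun k => bco z τ n (k + 1)) P := by
      have := ((Equiv.addRight (1 : ℤ)).hasSum_iff (f := bco z τ n) (a := P)).mpr ih
      exact this
    have j0 : HasSum (fun k => (1 + ce τ ^ (2 * n + 1)) * bco z τ n k)
      ((1 + ce τ ^ (2 * n + 1)) * P) := HasSum.mul_left _ ih
    have j1 : HasSum (fun k => ce z * ce τ ^ (n + 1) * bco z τ n (k - 1))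
      (ce z * ce τ ^ (n + 1) * P) := HasSum.mul_left _ i1
    have j2 : HasSum (fun k => (ce z)⁻¹ * ce τ ^ n * bco z τ n (k + 1))
      ((ce z)⁻¹ * ce τ ^ n * P) := HasSum.mul_left _ i2
    have j3 := (j0.sub j1).sub j2
    have f1 : bco z τ (n + 1) = fun k => (1 + ce τ ^ (2 * n + 1)) * bco z τ n k
        - ce z * ce τ ^ (n + 1) * bco z τ n (k - 1)
        - (ce z)⁻¹ * ce τ ^ n * bco z τ n (k + 1) := funext fun k => bco_succ hτ z n k
    have f2 : P * ((1 - ce z * ce τ * ce τ ^ n) * (1 - (ce z)⁻¹ * ce τ ^ n)) =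
        (1 + ce τ ^ (2 * n + 1)) * P - ce z * ce τ ^ (n + 1) * P - (ce z)⁻¹ * ce τ ^ n * P := by
      have hx := ce_ne z
      field_simp
      ring
    rw [f1, f2]
    exact j3

lemma triple {τ : ℂ} (hτ : 0 < τ.im) : ∃ C : ℂ, ∀ z : ℂ,
    (∏' j : ℕ, (1 - ce z * ce τ * ce τ ^ j)) * (∏' j : ℕ, (1 - (ce z)⁻¹ * ce τ ^ j))
      = C * jacobiTheta₂ (tsh z τ) τ := by
  have hq := norm_ce hτ
  obtain ⟨L, hL, hlim⟩ := qphi_tendsto hq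
  have hinv : Tendsto (fun n => (qphi (ce τ) n)⁻¹) atTop (𝓝 L⁻¹) := hlim.inv₀ hL
  obtain ⟨C1, hC1, hb1⟩ := bdd_of_tendsto hlim
  obtain ⟨C2, hC2, hb2⟩ := bdd_of_tendsto hinv
  have hbr : ∀ m, ‖qrec (ce τ) m‖ ≤ C2 := by
    intro m; unfold qrec; split_ifs
    · simpa using hC2
    · exact hb2 _
  have hr : ∀ u : ℕ → ℤ, Tendsto u atTop atTop →
      Tendsto (fun n => qrec (ce τ) (u n)) atTop (𝓝 L⁻¹) := by
    intro u hu
    have h1 : Tendsto (fun n => (u n).toNat) atTop atTop := by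
      refine tendsto_atTop.mpr fun b => ?_
      filter_upwards [hu.eventually_ge_atTop (b : ℤ)] with n hn
      omega
    refine (hinv.comp h1).congr' ?_
    filter_upwards [hu.eventually_ge_atTop 0] with n hn
    simp [qrec, not_lt.mpr hn]
  refine ⟨L * L⁻¹ * L⁻¹, fun z => ?_⟩
  have hfin := fun n => (finite_triple hτ z n).tsum_eq
  have lim1 : Tendsto (fun n => ∑' k, bco z τ n k) atTop
      (𝓝 (∑' k, jacobiTheta₂_term k (tsh z τ) τ * (L * L⁻¹ * L⁻¹))) := by
    refine tendsto_tsum_of_dominated_convergence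
      (bound := fun k => ‖jacobiTheta₂_term k (tsh z τ) τ‖ * (C1 * C2 * C2)) ?_ ?_ ?_
    · exact ((summable_jacobiTheta₂_term_iff (tsh z τ) τ).mpr hτ).norm.mul_right _
    · intro k
      unfold bco
      refine Tendsto.const_mul _ (Tendsto.mul (Tendsto.mul ?_ ?_) ?_)
      · exact hlim.comp (tendsto_id.const_mul_atTop' (by norm_num : 0 < 2))
      · exact hr _ (by
          simpa [sub_eq_add_neg] using
            tendsto_atTop_add_const_right atTop (-k) (tendsto_natCast_atTop_atTop (R := ℤ)))
      · exact hr _ (tendsto_atTop_add_const_right atTop k (tendsto_natCast_atTop_atTop (R := ℤ)))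
    · refine Eventually.of_forall fun n k => ?_
      unfold bco
      rw [norm_mul, norm_mul, norm_mul]
      gcongr
      · exact hb1 _
      · exact hbr _
      · exact hbr _
  have lim2 := (mult_geo hq (ce z * ce τ)).tendsto_prod_tprod_nat.mul
    (mult_geo hq ((ce z)⁻¹)).tendsto_prod_tprod_nat
  have := tendsto_nhds_unique (lim2.congr fun n => ?_) lim1
  · rw [this, tsum_mul_right, mul_comm, jacobiTheta₂]
  · rw [hfin n, Finset.prod_mul_distrib]

lemma ce_add (a b : ℂ) : ce (a + b) = ce a * ce b := by
  unfold ce; rw [mul_add, Complex.exp_add]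

lemma ce_neg (a : ℂ) : ce (-a) = (ce a)⁻¹ := by
  unfold ce; rw [mul_neg, Complex.exp_neg]

lemma ce_nat_mul (j : ℕ) (τ : ℂ) : ce (j * τ) = ce τ ^ j := by
  unfold ce; rw [← Complex.exp_nat_mul]; congr 1; ring

lemma theta_eq {τ : ℂ} (hτ : 0 < τ.im) : ∃ C : ℂ, ∀ z : ℂ,
    theta z τ = C * (ce (z / 2) * jacobiTheta₂ (tsh z τ) τ) := by
  obtain ⟨C, hC⟩ := triple hτ
  refine ⟨1 / (2 * Real.pi * Complex.I) * C, fun z => ?_⟩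
  have h := hC z
  have hm := mult_geo (norm_ce hτ) ((ce z)⁻¹ * ce τ)
  have h2 : (∏' j : ℕ, (1 - (ce z)⁻¹ * ce τ ^ j))
      = (1 - (ce z)⁻¹) * ∏' j : ℕ, (1 - (ce z)⁻¹ * ce τ * ce τ ^ j) := by
    rw [tprod_eq_zero_mul' (f := fun j : ℕ => (1 - (ce z)⁻¹ * ce τ ^ j))]
    · simp [pow_succ', mul_assoc]
    · simpa [pow_succ', mul_assoc] using hm
  have e1 : ∀ j : ℕ, ce (z + ((j : ℂ) + 1) * τ) = ce z * ce τ * ce τ ^ j := by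
    intro j; rw [ce_add, add_mul, ce_add, ce_nat_mul, one_mul]; ring
  have e2 : ∀ j : ℕ, ce (-z + ((j : ℂ) + 1) * τ) = (ce z)⁻¹ * ce τ * ce τ ^ j := by
    intro j; rw [ce_add, add_mul, ce_add, ce_nat_mul, one_mul, ce_neg]; ring
  have e3 : ce (z / 2) - ce (-z / 2) = ce (z / 2) * (1 - (ce z)⁻¹) := by
    have : ce z = ce (z / 2) * ce (z / 2) := by rw [← ce_add]; congr 1; ring
    rw [neg_div, ce_neg, this]
    have := ce_ne (z / 2)
    field_simp
  unfold theta
  simp only [e1, e2, e3]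
  rw [h2] at h
  linear_combination (1 / (2 * Real.pi * Complex.I)) * ce (z / 2) * h

/-- parity splitting of pairs of integers -/
def paritySplit : (ℤ × ℤ) ⊕ (ℤ × ℤ) ≃ ℤ × ℤ where
  toFun := Sum.elim (fun a => (a.1 + a.2, a.1 - a.2)) (fun a => (a.1 + a.2 + 1, a.1 - a.2))
  invFun b := if (b.1 + b.2) % 2 = 0 then Sum.inl ((b.1 + b.2) / 2, (b.1 - b.2) / 2)
    else Sum.inr ((b.1 + b.2) / 2, (b.1 - b.2) / 2)
  left_inv := by
    rintro (⟨r, s⟩ | ⟨r, s⟩)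
    · have h : (r + s + (r - s)) % 2 = 0 := by omega
      simp only [Sum.elim_inl, h, if_true, Sum.inl.injEq, Prod.mk.injEq]
      constructor <;> omega
    · have h : ¬ (r + s + 1 + (r - s)) % 2 = 0 := by omega
      simp only [Sum.elim_inr, h, if_false, Sum.inr.injEq, Prod.mk.injEq]
      constructor <;> omega
  right_inv := by
    rintro ⟨m, n⟩
    by_cases h : (m + n) % 2 = 0
    · simp only [h, if_true, Sum.elim_inl, Prod.mk.injEq]
      constructor <;> omega
    · simp only [h, if_false, Sum.elim_inr, Prod.mk.injEq]
      constructor <;> omega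

lemma hasSum_mulT {τ : ℂ} (hτ : 0 < τ.im) (a b : ℂ) :
    HasSum (fun x : ℤ × ℤ => jacobiTheta₂_term x.1 a τ * jacobiTheta₂_term x.2 b τ)
      (jacobiTheta₂ a τ * jacobiTheta₂ b τ) := by
  have h1 : Summable fun n : ℤ => jacobiTheta₂_term n a τ := (hasSum_jacobiTheta₂_term a hτ).summable
  have h2 : Summable fun n : ℤ => jacobiTheta₂_term n b τ := (hasSum_jacobiTheta₂_term b hτ).summable
  have n1 := h1.norm
  have n2 := h2.norm
  have h4 := tsum_mul_tsum_of_summable_norm n1 n2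
  unfold jacobiTheta₂
  rw [h4]
  exact (summable_mul_of_summable_norm n1 n2).hasSum

lemma T_prod {τ : ℂ} (hτ : 0 < τ.im) (a b : ℂ) :
    jacobiTheta₂ (a + b) τ * jacobiTheta₂ (a - b) τ
      = jacobiTheta₂ (2 * a) (2 * τ) * jacobiTheta₂ (2 * b) (2 * τ)
        + Complex.exp (Real.pi * I * τ + 2 * Real.pi * I * (a + b)) *
          (jacobiTheta₂ (2 * a + τ) (2 * τ) * jacobiTheta₂ (2 * b + τ) (2 * τ)) := by
  have hτ2 : 0 < (2 * τ).im := by simpa using hτ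
  have h := hasSum_mulT hτ (a + b) (a - b)
  have h1 := hasSum_mulT hτ2 (2 * a) (2 * b)
  have h2 := (hasSum_mulT hτ2 (2 * a + τ) (2 * b + τ)).mul_left
    (Complex.exp (Real.pi * I * τ + 2 * Real.pi * I * (a + b)))
  rw [← paritySplit.hasSum_iff] at h
  refine h.unique (HasSum.sum ?_ ?_)
  · have e : (fun x : ℤ × ℤ => jacobiTheta₂_term x.1 (2 * a) (2 * τ) *
        jacobiTheta₂_term x.2 (2 * b) (2 * τ)) =
        ((fun x : ℤ × ℤ => jacobiTheta₂_term x.1 (a + b) τ * jacobiTheta₂_term x.2 (a - b) τ) ∘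
          paritySplit) ∘ Sum.inl := by
      funext ⟨r, s⟩
      simp only [Function.comp_apply, paritySplit, Equiv.coe_fn_mk, Sum.elim_inl, jacobiTheta₂_term]
      rw [← Complex.exp_add, ← Complex.exp_add]
      congr 1
      push_cast
      ring
    rw [e] at h1
    exact h1
  · have e : (fun x : ℤ × ℤ => Complex.exp (Real.pi * I * τ + 2 * Real.pi * I * (a + b)) *
        (jacobiTheta₂_term x.1 (2 * a + τ) (2 * τ) *
        jacobiTheta₂_term x.2 (2 * b + τ) (2 * τ))) =
        ((fun x : ℤ × ℤ => jacobiTheta₂_term x.1 (a + b) τ * jacobiTheta₂_term x.2 (a - b) τ) ∘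
          paritySplit) ∘ Sum.inr := by
      funext ⟨r, s⟩
      simp only [Function.comp_apply, paritySplit, Equiv.coe_fn_mk, Sum.elim_inr, jacobiTheta₂_term]
      rw [← Complex.exp_add, ← Complex.exp_add, ← Complex.exp_add]
      congr 1
      push_cast
      ring
    rw [e] at h2
    exact h2

lemma theta_prod {τ : ℂ} (hτ : 0 < τ.im) : ∃ A B : ℂ → ℂ, ∀ x y : ℂ,
    theta (x + y) τ * theta (x - y) τ = B x * A y - A x * B y := by
  obtain ⟨C, hC⟩ := theta_eq hτ
  refine ⟨fun x => C * jacobiTheta₂ (2 * x) (2 * τ),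
    fun x => C * (ce x * jacobiTheta₂ (2 * x + τ) (2 * τ)), fun x y => ?_⟩
  have h := T_prod hτ (x + 1 / 2 + τ / 2) y
  have s1 : tsh (x + y) τ = x + 1 / 2 + τ / 2 + y := by unfold tsh; ring
  have s2 : tsh (x - y) τ = x + 1 / 2 + τ / 2 - y := by unfold tsh; ring
  have s3 : jacobiTheta₂ (2 * (x + 1 / 2 + τ / 2)) (2 * τ) = jacobiTheta₂ (2 * x + τ) (2 * τ) := by
    rw [← jacobiTheta₂_add_left (2 * x + τ)]; congr 1; ring
  have s4 : jacobiTheta₂ (2 * (x + 1 / 2 + τ / 2) + τ) (2 * τ)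
      = Complex.exp (-Real.pi * I * (2 * τ + 2 * (2 * x))) * jacobiTheta₂ (2 * x) (2 * τ) := by
    rw [← jacobiTheta₂_add_left', ← jacobiTheta₂_add_left (2 * x + 2 * τ)]; congr 1; ring
  have s5 : ce ((x + y) / 2) * ce ((x - y) / 2) = ce x := by rw [← ce_add]; congr 1; ring
  have s6 : ce x * (Complex.exp (Real.pi * I * τ + 2 * Real.pi * I * (x + 1 / 2 + τ / 2 + y)) *
      Complex.exp (-Real.pi * I * (2 * τ + 2 * (2 * x)))) = -ce y := by
    rw [neg_eq_neg_one_mul (ce y), ← Complex.exp_pi_mul_I]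
    unfold ce
    rw [← Complex.exp_add, ← Complex.exp_add, ← Complex.exp_add]
    congr 1; ring
  rw [hC, hC, s1, s2]
  rw [s3, s4] at h
  linear_combination C ^ 2 * (ce ((x + y) / 2) * ce ((x - y) / 2)) * h
    + C ^ 2 * s5 * (jacobiTheta₂ (2 * x + τ) (2 * τ) * jacobiTheta₂ (2 * y) (2 * τ)
      + Complex.exp (Real.pi * I * τ + 2 * Real.pi * I * (x + 1 / 2 + τ / 2 + y)) *
        (Complex.exp (-Real.pi * I * (2 * τ + 2 * (2 * x))) * jacobiTheta₂ (2 * x) (2 * τ) *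
          jacobiTheta₂ (2 * y + τ) (2 * τ)))
    + C ^ 2 * s6 * (jacobiTheta₂ (2 * x) (2 * τ) * jacobiTheta₂ (2 * y + τ) (2 * τ))

lemma theta_neg (z τ : ℂ) : theta (-z) τ = -theta z τ := by
  unfold theta
  rw [neg_neg]
  ring

lemma weierstrass {τ : ℂ} (hτ : 0 < τ.im) (p p' z z' : ℂ) :
    theta (p + z) τ * theta (p + p' + z') τ * theta p' τ * theta (z + z') τ
      - theta (p' + z') τ * theta (p + (z + z')) τ * theta z τ * theta (p + p') τ
      - theta (p + p' + (z + z')) τ * theta (p' + -z) τ * theta p τ * theta z' τ = 0 := by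
  obtain ⟨A, B, h⟩ := theta_prod hτ
  have key : ∀ X Y U V : ℂ,
      (theta (X + U) τ * theta (X - U) τ) * (theta (Y + V) τ * theta (Y - V) τ)
      - (theta (X + V) τ * theta (X - V) τ) * (theta (Y + U) τ * theta (Y - U) τ)
      - (theta (X + Y) τ * theta (X - Y) τ) * (theta (U + V) τ * theta (U - V) τ) = 0 := by
    intro X Y U V
    simp only [h]
    ring
  have k := key (p' + (p + z') / 2) (z + (p + z') / 2) ((p + z') / 2) ((p - z') / 2)
  rw [show p' + (p + z') / 2 + (p + z') / 2 = p + p' + z' by ring,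
    show p' + (p + z') / 2 - (p + z') / 2 = p' by ring,
    show z + (p + z') / 2 + (p - z') / 2 = p + z by ring,
    show z + (p + z') / 2 - (p - z') / 2 = z + z' by ring,
    show p' + (p + z') / 2 + (p - z') / 2 = p + p' by ring,
    show p' + (p + z') / 2 - (p - z') / 2 = p' + z' by ring,
    show z + (p + z') / 2 + (p + z') / 2 = p + (z + z') by ring,
    show z + (p + z') / 2 - (p + z') / 2 = z by ring,
    show p' + (p + z') / 2 + (z + (p + z') / 2) = p + p' + (z + z') by ring,
    show p' + (p + z') / 2 - (z + (p + z') / 2) = p' + -z by ring,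
    show (p + z') / 2 + (p - z') / 2 = p by ring,
    show (p + z') / 2 - (p - z') / 2 = z' by ring] at k
  linear_combination k

/-- the Fay identity for `F` with exponential factors. -/
theorem statement8 (τ : ℂ) (hτ : 0 < τ.im) (t t' : ℂ) (p p' z z' : ℂ)
    (hp : theta p τ ≠ 0) (hp' : theta p' τ ≠ 0)
    (hz : theta z τ ≠ 0) (hz' : theta z' τ ≠ 0)
    (hpp' : theta (p + p') τ ≠ 0) (hzz' : theta (z + z') τ ≠ 0) :
    Ftheta p z τ * Complex.exp (-t * z) *
        (Ftheta (p + p') z' τ * Complex.exp (-(t + t') * z'))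
      - Ftheta p' z' τ * Complex.exp (-t' * z') *
        (Ftheta p (z + z') τ * Complex.exp (-t * (z + z')))
      + Ftheta (p + p') (z + z') τ * Complex.exp (-(t + t') * (z + z')) *
        (Ftheta p' (-z) τ * Complex.exp (t' * z)) = 0 := by
  have w := weierstrass hτ p p' z z'
  have E1 : Complex.exp (-t * z) * Complex.exp (-(t + t') * z')
      = Complex.exp (-t * (z + z') - t' * z') := by
    rw [← Complex.exp_add]; congr 1; ring
  have E2 : Complex.exp (-t' * z') * Complex.exp (-t * (z + z'))
      = Complex.exp (-t * (z + z') - t' * z') := by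
    rw [← Complex.exp_add]; congr 1; ring
  have E3 : Complex.exp (-(t + t') * (z + z')) * Complex.exp (t' * z)
      = Complex.exp (-t * (z + z') - t' * z') := by
    rw [← Complex.exp_add]; congr 1; ring
  have main : Ftheta p z τ * Ftheta (p + p') z' τ - Ftheta p' z' τ * Ftheta p (z + z') τ
      + Ftheta (p + p') (z + z') τ * Ftheta p' (-z) τ = 0 := by
    unfold Ftheta
    rw [theta_neg z τ]
    generalize theta (p + z) τ = a1 at *
    generalize theta (p + p' + z') τ = a2 at *
    generalize theta (p' + z') τ = a3 at *
    generalize theta (p + (z + z')) τ = a4 at *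
    generalize theta (p + p' + (z + z')) τ = a5 at *
    generalize theta (p' + -z) τ = a6 at *
    generalize theta (z + z') τ = a7 at *
    generalize theta (p + p') τ = a8 at *
    generalize theta p τ = a9 at *
    generalize theta p' τ = b1 at *
    generalize theta z τ = b2 at *
    generalize theta z' τ = b3 at *
    have : a1 / (a9 * b2) * (a2 / (a8 * b3)) - a3 / (b1 * b3) * (a4 / (a9 * a7))
        + a5 / (a8 * a7) * (a6 / (b1 * -b2))
        = (a1 * a2 * b1 * a7 - a3 * a4 * b2 * a8 - a5 * a6 * a9 * b3)
          / (a9 * b2 * a8 * b3 * b1 * a7) := by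
      field_simp
      ring
    rw [this, w, zero_div]
  linear_combination (Ftheta p z τ * Ftheta (p + p') z' τ) * E1
    - (Ftheta p' z' τ * Ftheta p (z + z') τ) * E2
    + (Ftheta (p + p') (z + z') τ * Ftheta p' (-z) τ) * E3
    + Complex.exp (-t * (z + z') - t' * z') * main
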